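/- Let p ≥ 5 and q ≥ 4 be integers, let k ≥ 2, and let n be an integer with n_k < n < n_{k+1}. Set l_k = (n_{k+1} − n_k)/p and φ_k = α^{−k}(α − β), and let d_k = U_k^p (the p-fold concatenation of U_k), writing d_k(i) for its i-th letter. If m ≥ 0 is the integer satisfying Σ_{i=1}^{m} (q − d_k(i)) ≤ n − n_k − 1 < Σ_{i=1}^{m+1} (q − d_k(i)) (the empty sum being 0), then m = ⌊ (n − n_k − φ_k)/β − ⌊(n − n_k − 1)/l_k⌋ · α^{−k} ⌋. -/

import Mathlib

/-- `α = (((p−2)(q−2)−2) + √(((p−2)(q−2)−2)² − 4))/2`. -/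
noncomputable def hypAlpha (p q : ℕ) : ℝ :=
  ((((p : ℝ) - 2) * ((q : ℝ) - 2) - 2) +
      Real.sqrt ((((p : ℝ) - 2) * ((q : ℝ) - 2) - 2) ^ 2 - 4)) / 2

/-- `β = ((p−2)(q−2) + √((p−2)²(q−2)² − 4(p−2)(q−2)))/(2(p−2))`. -/
noncomputable def hypBeta (p q : ℕ) : ℝ :=
  (((p : ℝ) - 2) * ((q : ℝ) - 2) +
      Real.sqrt (((p : ℝ) - 2) ^ 2 * ((q : ℝ) - 2) ^ 2 -
        4 * (((p : ℝ) - 2) * ((q : ℝ) - 2)))) / (2 * ((p : ℝ) - 2))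

/-- `n_k = 1 + (p(q−2)/(α − α^{−1}))·((α^k − 1)/(α − 1) − (α^{−k} − 1)/(α^{−1} − 1))`. -/
noncomputable def hypN (p q : ℕ) (k : ℕ) : ℝ :=
  1 + ((p : ℝ) * ((q : ℝ) - 2) / (hypAlpha p q - (hypAlpha p q)⁻¹)) *
    (((hypAlpha p q) ^ k - 1) / (hypAlpha p q - 1) -
      ((hypAlpha p q)⁻¹ ^ k - 1) / ((hypAlpha p q)⁻¹ - 1))

/-- `a`-fold concatenation of a word. -/
def wpow (X : List ℕ) (a : ℕ) : List ℕ := (List.replicate a X).flatten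

/-- For `p ≥ 4`, `q ≥ 4`: `UW p q k = (U_{k+1}, W_{k+1})`, where `U_1 = (2)`, `W_1 = (3)`,
`U_{k+1} = W_k U_k^{p−4} (W_k U_k^{p−3})^{q−3}` and `W_{k+1} = W_k U_k^{p−4} (W_k U_k^{p−3})^{q−4}`. -/
def UW (p q : ℕ) : ℕ → List ℕ × List ℕ
  | 0 => ([2], [3])
  | k + 1 =>
      ((UW p q k).2 ++ wpow (UW p q k).1 (p - 4) ++
        wpow ((UW p q k).2 ++ wpow (UW p q k).1 (p - 3)) (q - 3),
       (UW p q k).2 ++ wpow (UW p q k).1 (p - 4) ++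
        wpow ((UW p q k).2 ++ wpow (UW p q k).1 (p - 3)) (q - 4))

def ws (q : ℝ) (X : List ℕ) : ℝ := (X.map (fun x : ℕ => q - (x : ℝ))).sum

def dl (q B : ℝ) (X : List ℕ) : ℝ := ws q X * B - X.length

lemma ws_append (q : ℝ) (X Y : List ℕ) : ws q (X ++ Y) = ws q X + ws q Y := by
  simp [ws]

lemma wpow_succ (X : List ℕ) (a : ℕ) : wpow X (a + 1) = X ++ wpow X a := by
  simp [wpow, List.replicate_succ]

lemma wpow_zero (X : List ℕ) : wpow X 0 = [] := by
  simp [wpow]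

lemma ws_nil (q : ℝ) : ws q [] = 0 := by simp [ws]

lemma ws_wpow (q : ℝ) (X : List ℕ) (a : ℕ) : ws q (wpow X a) = a * ws q X := by
  induction a with
  | zero => simp [wpow_zero, ws_nil]
  | succ a ih => rw [wpow_succ, ws_append, ih]; push_cast; ring

lemma length_wpow (X : List ℕ) (a : ℕ) : (wpow X a).length = a * X.length := by
  simp [wpow]

lemma dl_append (q B : ℝ) (X Y : List ℕ) : dl q B (X ++ Y) = dl q B X + dl q B Y := by
  simp only [dl, ws_append, List.length_append]; push_cast; ring

lemma dl_wpow (q B : ℝ) (X : List ℕ) (a : ℕ) : dl q B (wpow X a) = a * dl q B X := by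
  simp only [dl, ws_wpow, length_wpow]; push_cast; ring

def Good (q B lo hi : ℝ) (X : List ℕ) : Prop :=
  (∀ i, i < X.length → lo ≤ dl q B (X.take i)) ∧ (∀ i, dl q B (X.take i) ≤ hi)

lemma Good.mono {q B lo hi lo' hi' : ℝ} {X : List ℕ} (h : Good q B lo hi X) (h1 : lo' ≤ lo)
    (h2 : hi ≤ hi') : Good q B lo' hi' X :=
  ⟨fun i hi => h1.trans (h.1 i hi), fun i => (h.2 i).trans h2⟩

lemma Good.append {q B lo hi : ℝ} {X Y : List ℕ} (hX : Good q B lo hi X)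
    (hY : Good q B (lo - dl q B X) (hi - dl q B X) Y) : Good q B lo hi (X ++ Y) := by
  constructor
  · intro i hi
    rcases lt_or_ge i X.length with h | h
    · rw [List.take_append_of_le_length h.le]; exact hX.1 i h
    · obtain ⟨j, rfl⟩ := Nat.exists_eq_add_of_le h
      rw [List.take_length_add_append, dl_append]
      have := hY.1 j (by simp at hi; omega)
      linarith
  · intro i
    rcases lt_or_ge i X.length with h | h
    · rw [List.take_append_of_le_length h.le]; exact hX.2 i
    · obtain ⟨j, rfl⟩ := Nat.exists_eq_add_of_le h
      rw [List.take_length_add_append, dl_append]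
      have := hY.2 j
      linarith

lemma Good.wpow {q B lo hi' : ℝ} {X : List ℕ} (hX : Good q B lo hi' X) (h0 : 0 ≤ dl q B X)
    (a : ℕ) : ∀ lo' hi : ℝ, lo' ≤ lo → 0 ≤ hi → (0 < a → hi' + ((a : ℝ) - 1) * dl q B X ≤ hi) →
      Good q B lo' hi (wpow X a) := by
  induction a with
  | zero =>
    intro lo' hi _ h _
    rw [wpow_zero]
    exact ⟨by simp, by simp [dl, ws_nil, h]⟩
  | succ a ih =>
    intro lo' hi h1 h2 h3
    have h3 := h3 (Nat.succ_pos a)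
    push_cast at h3
    have ha : (0 : ℝ) ≤ a := Nat.cast_nonneg a
    have hm : 0 ≤ (a : ℝ) * dl q B X := mul_nonneg ha h0
    rw [wpow_succ]
    refine (hX.mono h1 (by linarith)).append (ih _ _ (by linarith) ?_ ?_)
    · have := hX.2 X.length
      rw [List.take_length] at this
      rcases Nat.eq_zero_or_pos a with h | h
      · subst h; simp at h3; linarith
      · have : (1 : ℝ) ≤ a := by exact_mod_cast h
        have h5 : dl q B X ≤ (a : ℝ) * dl q B X := by nlinarith
        linarith
    · intro _; linarith

lemma inv (p q : ℕ) (hp : 5 ≤ p) (hq : 4 ≤ q) (a r B : ℝ) (har : a * r = 1) (ha : 1 < a)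
    (hB : B < 1) (hB0 : 0 < B) (hr : 0 < r) (haB : 2 < a * B)
    (h1 : ((q : ℝ) - 2) * B = 1 + r) (h2 : (p : ℝ) - 2 = B * (a + 1)) (k : ℕ) :
    dl q B (UW p q k).1 = r ^ (k + 1) ∧ dl q B (UW p q k).2 = r ^ (k + 1) * (1 - a * B) ∧
    Good q B (B * (r ^ k - 1)) (r ^ (k + 1)) (UW p q k).1 ∧
    Good q B (B * (r ^ k - 1)) 0 (UW p q k).2 := by
  induction k with
  | zero =>
    have e1 : dl q B [2] = r := by simp [dl, ws]; linarith
    have e2 : dl q B [3] = r * (1 - a * B) := by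
      simp [dl, ws]; linear_combination h1 + B * har
    have e0 : dl q B [] = 0 := by simp [dl, ws]
    have e2' : r * (1 - a * B) ≤ 0 := by nlinarith
    simp only [UW, zero_add, pow_one, pow_zero, sub_self, mul_zero]
    refine ⟨e1, e2, ⟨?_, ?_⟩, ⟨?_, ?_⟩⟩
    · intro i hi
      have : i = 0 := by simpa using hi
      subst this; simp [e0]
    · intro i
      rcases i with _ | i
      · simp [e0, hr.le]
      · simp [e1]
    · intro i hi
      have : i = 0 := by simpa using hi
      subst this; simp [e0]
    · intro i
      rcases i with _ | i
      · simp [e0]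
      · simpa [e2] using e2'
  | succ k ih =>
    obtain ⟨dU, dW, gU, gW⟩ := ih
    have hrk : r ^ k = a * r ^ (k + 1) := by rw [pow_succ]; linear_combination (-r^k) * har
    have hu : 0 < r ^ (k + 1) := pow_pos hr _
    rw [hrk] at gU gW
    rw [pow_succ r (k + 1)]
    simp only [UW]
    generalize (UW p q k).1 = U at *
    generalize (UW p q k).2 = W at *
    generalize r ^ (k + 1) = u at *
    have c4 : ((p - 4 : ℕ) : ℝ) = B * (a + 1) - 2 := by
      rw [Nat.cast_sub (by omega)]; push_cast; linarith
    have c3 : ((p - 3 : ℕ) : ℝ) = B * (a + 1) - 1 := by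
      rw [Nat.cast_sub (by omega)]; push_cast; linarith
    have q3 : ((q - 3 : ℕ) : ℝ) = (q : ℝ) - 3 := by
      rw [Nat.cast_sub (by omega)]; push_cast; ring
    have q4 : ((q - 4 : ℕ) : ℝ) = (q : ℝ) - 4 := by
      rw [Nat.cast_sub (by omega)]; push_cast; ring
    have hq' : (4 : ℝ) ≤ q := by exact_mod_cast hq
    have dV : dl q B (W ++ wpow U (p - 4)) = u * (B - 1) := by
      rw [dl_append, dl_wpow, dU, dW, c4]; ring
    have dT : dl q B (W ++ wpow U (p - 3)) = u * B := by
      rw [dl_append, dl_wpow, dU, dW, c3]; ring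
    have hw : u * (1 - a * B) ≤ 0 := by nlinarith
    have hv : u * (B - 1) ≤ 0 := by nlinarith
    have hwu : 0 ≤ -(u * (1 - a * B)) := by linarith
    have huB : 0 < u * B := mul_pos hu hB0
    have gV : Good q B (B * (a * u - 1) + u * (1 - a * B)) 0 (W ++ wpow U (p - 4)) := by
      refine (gW.mono (by linarith) le_rfl).append ?_
      rw [dW]
      refine gU.wpow (by rw [dU]; exact hu.le) _ _ _ (by linarith) (by linarith) ?_
      intro _
      rw [c4, dU]; linarith
    have gT : Good q B (B * (a * u - 1) + u * (1 - a * B)) (u * B) (W ++ wpow U (p - 3)) := by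
      refine (gW.mono (by linarith) huB.le).append ?_
      rw [dW]
      refine gU.wpow (by rw [dU]; exact hu.le) _ _ _ (by linarith) (by linarith) ?_
      intro _
      rw [c3, dU]; linarith
    generalize W ++ wpow U (p - 4) = V at *
    generalize W ++ wpow U (p - 3) = T at *
    have E1 : u * (B - 1) + ((q : ℝ) - 3) * (u * B) = u * r := by linear_combination u * h1
    have E2 : u * (B - 1) + ((q : ℝ) - 4) * (u * B) = u * r * (1 - a * B) := by
      linear_combination u * h1 + u * B * har
    have hur : 0 < u * r := mul_pos hu hr
    have hw' : u * r * (1 - a * B) ≤ 0 := by nlinarith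
    refine ⟨?_, ?_, ?_, ?_⟩
    · rw [dl_append, dl_wpow, dV, dT, q3, E1]
    · rw [dl_append, dl_wpow, dV, dT, q4, E2]
    · refine (gV.mono (by linarith) hur.le).append ?_
      rw [dV]
      refine gT.wpow (by rw [dT]; exact huB.le) _ _ _ (by linarith) (by linarith) ?_
      intro _
      rw [q3, dT]; linarith
    · refine (gV.mono (by linarith) le_rfl).append ?_
      rw [dV]
      refine gT.wpow (by rw [dT]; exact huB.le) _ _ _ (by linarith) (by linarith) ?_
      intro _
      rw [q4, dT]; linarith

lemma letters (p q : ℕ) (k : ℕ) : (∀ x ∈ (UW p q k).1, x ≤ 3) ∧ (∀ x ∈ (UW p q k).2, x ≤ 3) := by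
  induction k with
  | zero => simp [UW]
  | succ k ih =>
    have key : ∀ x, (x ∈ (UW p q (k+1)).1 ∨ x ∈ (UW p q (k+1)).2) →
        (x ∈ (UW p q k).1 ∨ x ∈ (UW p q k).2) := by
      intro x hx
      have hw : ∀ (X : List ℕ) (a : ℕ), x ∈ wpow X a → x ∈ X := by
        intro X a h
        simp only [wpow, List.mem_flatten, List.mem_replicate] at h
        obtain ⟨l, ⟨-, rfl⟩, hx⟩ := h
        exact hx
      have hT : ∀ a b, x ∈ wpow ((UW p q k).2 ++ wpow (UW p q k).1 a) b →
          (x ∈ (UW p q k).1 ∨ x ∈ (UW p q k).2) := by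
        intro a b h
        rcases List.mem_append.1 (hw _ _ h) with h | h
        · exact Or.inr h
        · exact Or.inl (hw _ _ h)
      simp only [UW, List.mem_append] at hx
      rcases hx with ((h | h) | h) | ((h | h) | h)
      · exact Or.inr h
      · exact Or.inl (hw _ _ h)
      · exact hT _ _ h
      · exact Or.inr h
      · exact Or.inl (hw _ _ h)
      · exact hT _ _ h
    exact ⟨fun x hx => (key x (Or.inl hx)).elim (ih.1 x) (ih.2 x),
      fun x hx => (key x (Or.inr hx)).elim (ih.1 x) (ih.2 x)⟩

noncomputable def FF (a r : ℝ) (k : ℕ) : ℝ := (a ^ k - r ^ k) / (a - r)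

lemma FF_rec (a r c : ℝ) (har : a * r = 1) (hs : a + r = c) (k : ℕ) :
    FF a r (k + 2) = c * FF a r (k + 1) - FF a r k := by
  subst hs
  unfold FF
  rw [← mul_div_assoc, ← sub_div]
  congr 1
  linear_combination (r ^ k - a ^ k) * har

lemma FF_one (a r : ℝ) (h : a - r ≠ 0) : FF a r 1 = 1 := by
  simp [FF, div_self h]

lemma FF_zero (a r : ℝ) : FF a r 0 = 0 := by simp [FF]

lemma FF_int (a r : ℝ) (c : ℤ) (har : a * r = 1) (hs : a + r = c) (h : a - r ≠ 0) (k : ℕ) :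
    (∃ z : ℤ, FF a r k = z) ∧ (∃ z : ℤ, FF a r (k + 1) = z) := by
  induction k with
  | zero => exact ⟨⟨0, by simp [FF_zero]⟩, ⟨1, by simp [FF_one a r h]⟩⟩
  | succ k ih =>
    obtain ⟨⟨x, hx⟩, ⟨y, hy⟩⟩ := ih
    exact ⟨⟨y, hy⟩, ⟨c * y - x, by rw [FF_rec a r c har hs, hx, hy]; push_cast; ring⟩⟩

lemma ws_UW (p q : ℕ) (hp : 5 ≤ p) (hq : 4 ≤ q) (a r : ℝ) (har : a * r = 1)
    (hs : a + r = ((p : ℝ) - 2) * ((q : ℝ) - 2) - 2) (h : a - r ≠ 0) (k : ℕ) :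
    ws q (UW p q k).1 = ((q : ℝ) - 2) * FF a r (k + 1) ∧
    ws q (UW p q k).2 = ((q : ℝ) - 3) * FF a r (k + 1) - FF a r k := by
  induction k with
  | zero => simp [UW, ws, FF_one a r h, FF_zero]
  | succ k ih =>
    obtain ⟨hU, hW⟩ := ih
    have c4 : ((p - 4 : ℕ) : ℝ) = (p : ℝ) - 4 := by
      rw [Nat.cast_sub (by omega)]; push_cast; ring
    have c3 : ((p - 3 : ℕ) : ℝ) = (p : ℝ) - 3 := by
      rw [Nat.cast_sub (by omega)]; push_cast; ring
    have q3 : ((q - 3 : ℕ) : ℝ) = (q : ℝ) - 3 := by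
      rw [Nat.cast_sub (by omega)]; push_cast; ring
    have q4 : ((q - 4 : ℕ) : ℝ) = (q : ℝ) - 4 := by
      rw [Nat.cast_sub (by omega)]; push_cast; ring
    simp only [UW, ws_append, ws_wpow, hU, hW, c4, c3, q3, q4, FF_rec a r _ har hs]
    constructor <;> ring

lemma hypN_step (p q k : ℕ) (h1 : 1 < hypAlpha p q) :
    hypN p q (k + 1) - hypN p q k =
      p * (((q : ℝ) - 2) * FF (hypAlpha p q) (hypAlpha p q)⁻¹ k) := by
  unfold hypN FF
  generalize hypAlpha p q = a at *
  have ha : a ≠ 0 := by linarith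
  have hr : a⁻¹ < 1 := inv_lt_one_of_one_lt₀ h1
  generalize a⁻¹ = r at *
  have e1 : a - 1 ≠ 0 := by linarith
  have e2 : r - 1 ≠ 0 := by linarith
  have e3 : a - r ≠ 0 := by linarith
  field_simp
  ring

lemma hypN_zero (p q : ℕ) : hypN p q 0 = 1 := by simp [hypN]

lemma sum_getD (q : ℝ) (X : List ℕ) (m : ℕ) (hm : m ≤ X.length) :
    ∑ i ∈ Finset.range m, (q - ((X.getD i 0 : ℕ) : ℝ)) = ws q (X.take m) := by
  induction m with
  | zero => simp [ws]
  | succ m ih =>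
    have h : m < X.length := hm
    rw [Finset.sum_range_succ, ih h.le, List.take_succ_eq_append_getElem h, ws_append]
    simp [ws, h]

lemma take_wpow (X : List ℕ) (i : ℕ) (hi : i ≤ X.length) (j : ℕ) : ∀ a, j < a →
    (wpow X a).take (j * X.length + i) = wpow X j ++ X.take i := by
  induction j with
  | zero =>
    intro a ha
    obtain ⟨b, rfl⟩ : ∃ b, a = b + 1 := ⟨a - 1, by omega⟩
    rw [wpow_succ, wpow_zero, zero_mul, zero_add, List.take_append_of_le_length hi]; rfl
  | succ j ih =>
    intro a ha
    obtain ⟨b, rfl⟩ : ∃ b, a = b + 1 := ⟨a - 1, by omega⟩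
    rw [wpow_succ, wpow_succ, show (j + 1) * X.length + i = X.length + (j * X.length + i) by ring,
      List.take_length_add_append, ih b (by omega), List.append_assoc]

lemma ws_nonneg (q : ℝ) (X : List ℕ) (h : ∀ x ∈ X, (x : ℝ) ≤ q) : 0 ≤ ws q X := by
  unfold ws
  apply List.sum_nonneg
  intro y hy
  obtain ⟨x, hx, rfl⟩ := List.mem_map.1 hy
  linarith [h x hx]

lemma params (p q : ℕ) (hp : 5 ≤ p) (hq : 4 ≤ q) :
    1 < hypAlpha p q ∧ hypAlpha p q + (hypAlpha p q)⁻¹ = ((p : ℝ) - 2) * ((q : ℝ) - 2) - 2 ∧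
    hypBeta p q = (hypAlpha p q + 1) / ((p : ℝ) - 2) := by
  have hp' : (5 : ℝ) ≤ p := by exact_mod_cast hp
  have hq' : (4 : ℝ) ≤ q := by exact_mod_cast hq
  have hA : 6 ≤ ((p : ℝ) - 2) * ((q : ℝ) - 2) := by nlinarith
  have e3 : hypBeta p q = (hypAlpha p q + 1) / ((p : ℝ) - 2) := by
    unfold hypBeta hypAlpha
    have hp2 : (p : ℝ) - 2 ≠ 0 := by linarith
    rw [show ((p : ℝ) - 2) ^ 2 * ((q : ℝ) - 2) ^ 2 - 4 * (((p : ℝ) - 2) * ((q : ℝ) - 2)) =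
      (((p : ℝ) - 2) * ((q : ℝ) - 2) - 2) ^ 2 - 4 by ring]
    field_simp
    ring
  refine ⟨?_, ?_, e3⟩
  · unfold hypAlpha
    have := Real.sqrt_nonneg ((((p : ℝ) - 2) * ((q : ℝ) - 2) - 2) ^ 2 - 4)
    linarith
  · have hpos : 0 < hypAlpha p q := by
      unfold hypAlpha
      have := Real.sqrt_nonneg ((((p : ℝ) - 2) * ((q : ℝ) - 2) - 2) ^ 2 - 4)
      linarith
    have hsq : hypAlpha p q * hypAlpha p q + 1 =
        (((p : ℝ) - 2) * ((q : ℝ) - 2) - 2) * hypAlpha p q := by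
      unfold hypAlpha
      have := Real.sq_sqrt (show 0 ≤ (((p : ℝ) - 2) * ((q : ℝ) - 2) - 2) ^ 2 - 4 by nlinarith)
      generalize √((((p : ℝ) - 2) * ((q : ℝ) - 2) - 2) ^ 2 - 4) = s at *
      generalize ((p : ℝ) - 2) * ((q : ℝ) - 2) = A at *
      linear_combination this / 4
    field_simp
    linarith

/-- Formula for `m(n)` (`p ≥ 5`, `q ≥ 4`, `k ≥ 2`, `n_k < n < n_{k+1}`):
if `Σ_{i=1}^m (q − d_k(i)) ≤ n − n_k − 1 < Σ_{i=1}^{m+1} (q − d_k(i))`, where `d_k = U_k^p`, then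
`m = ⌊(n − n_k − φ_k)/β − ⌊(n − n_k − 1)/l_k⌋·α^{−k}⌋`, where `l_k = (n_{k+1} − n_k)/p`
and `φ_k = α^{−k}(α − β)`. -/
theorem m_formula (p q : ℕ) (hp : 5 ≤ p) (hq : 4 ≤ q) (k : ℕ) (hk : 2 ≤ k)
    (n : ℤ) (hn1 : hypN p q k < (n : ℝ)) (hn2 : (n : ℝ) < hypN p q (k + 1))
    (m : ℕ)
    (hm1 : ∑ i ∈ Finset.range m,
        ((q : ℝ) - ((wpow (UW p q (k - 1)).1 p).getD i 0 : ℕ)) ≤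
      (n : ℝ) - hypN p q k - 1)
    (hm2 : (n : ℝ) - hypN p q k - 1 < ∑ i ∈ Finset.range (m + 1),
        ((q : ℝ) - ((wpow (UW p q (k - 1)).1 p).getD i 0 : ℕ))) :
    (m : ℤ) = ⌊((n : ℝ) - hypN p q k - (hypAlpha p q)⁻¹ ^ k * (hypAlpha p q - hypBeta p q)) /
          hypBeta p q -
        (⌊((n : ℝ) - hypN p q k - 1) / ((hypN p q (k + 1) - hypN p q k) / (p : ℝ))⌋ : ℝ) *
          (hypAlpha p q)⁻¹ ^ k⌋ := by
  obtain ⟨ha, hs, hb⟩ := params p q hp hq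
  have hp' : (5 : ℝ) ≤ p := by exact_mod_cast hp
  have hq' : (4 : ℝ) ≤ q := by exact_mod_cast hq
  obtain ⟨k, rfl⟩ : ∃ k', k = k' + 1 := ⟨k - 1, by omega⟩
  simp only [Nat.add_sub_cancel] at hm1 hm2
  have hstep := fun k => hypN_step p q k ha
  have ha0 : hypAlpha p q ≠ 0 := by linarith
  have har : hypAlpha p q * (hypAlpha p q)⁻¹ = 1 := mul_inv_cancel₀ ha0
  have hr : 0 < (hypAlpha p q)⁻¹ := by positivity
  have hr1 : (hypAlpha p q)⁻¹ < 1 := inv_lt_one_of_one_lt₀ ha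
  have hb0 : 0 < hypBeta p q := by rw [hb]; apply div_pos <;> linarith
  have hbB : hypBeta p q * (hypBeta p q)⁻¹ = 1 := mul_inv_cancel₀ hb0.ne'
  have hbp : hypBeta p q * ((p : ℝ) - 2) = hypAlpha p q + 1 := by
    rw [hb]; field_simp [show (p : ℝ) - 2 ≠ 0 by linarith]
  have hN0 := hypN_zero p q
  rw [div_eq_mul_inv _ (hypBeta p q)]
  have hB0 : 0 < (hypBeta p q)⁻¹ := by positivity
  clear hb
  generalize hypAlpha p q = a at *
  generalize a⁻¹ = r at *
  generalize hypBeta p q = b at *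
  generalize b⁻¹ = B at *
  have h2 : (p : ℝ) - 2 = B * (a + 1) := by
    linear_combination B * hbp - ((p : ℝ) - 2) * hbB
  have haA : ((p : ℝ) - 2) * 2 - 3 < a := by nlinarith
  have hB1 : B < 1 := by
    by_contra hcon
    push Not at hcon
    nlinarith
  have haB : 2 < a * B := by nlinarith
  have h1 : ((q : ℝ) - 2) * B = 1 + r := by
    have e : (B * (a + 1)) * ((q : ℝ) - 2) = a + r + 2 := by rw [← h2]; linarith
    have e' : (a + 1) * (((q : ℝ) - 2) * B - (1 + r)) = 0 := by linear_combination e - har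
    rcases mul_eq_zero.1 e' with h | h <;> linarith
  have hne : a - r ≠ 0 := by linarith
  have hint : ∀ k, ∃ z : ℤ, hypN p q k = z := by
    intro k
    induction k with
    | zero => exact ⟨1, by simp [hN0]⟩
    | succ k ih =>
      obtain ⟨z, hz⟩ := ih
      obtain ⟨y, hy⟩ := (FF_int a r (((p : ℤ) - 2) * ((q : ℤ) - 2) - 2) har
        (by push_cast; exact hs) hne k).1
      refine ⟨z + p * (((q : ℤ) - 2) * y), ?_⟩
      have := hstep k
      rw [hy] at this
      push_cast
      linarith
  obtain ⟨dU, -, gU, -⟩ := inv p q hp hq a r B har ha hB1 hB0 hr haB h1 h2 k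
  have hl := (ws_UW p q hp hq a r har hs hne k).1
  have hlet := (letters p q k).1
  have hD := hstep (k + 1)
  rw [← hl] at hD
  rw [hD, mul_div_cancel_left₀ _ (by linarith : (p : ℝ) ≠ 0)]
  generalize (UW p q k).1 = U at *
  have hn2' : (n : ℝ) - hypN p q (k + 1) < p * ws q U := by linarith
  obtain ⟨z, hz⟩ := hint (k + 1)
  rw [hz] at hm1 hm2 hn2' ⊢
  clear hD hn2 hstep hint hN0
  -- integer t
  obtain ⟨t, ht⟩ : ∃ t : ℤ, t = n - z - 1 := ⟨_, rfl⟩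
  have htR : (n : ℝ) - z - 1 = t := by rw [ht]; push_cast; ring
  have htR' : (n : ℝ) - z = t + 1 := by linarith
  rw [htR] at hm1 hm2 ⊢
  rw [htR'] at hn2' ⊢
  have hgetD : ∀ i, (((wpow U p).getD i 0 : ℕ) : ℝ) ≤ 3 := by
    intro i
    have : (wpow U p).getD i 0 ≤ 3 := by
      rw [List.getD_eq_getElem?_getD]
      rcases h : (wpow U p)[i]? with _ | x
      · simp
      · have := List.mem_of_getElem? h
        simp only [wpow, List.mem_flatten, List.mem_replicate] at this
        obtain ⟨l, ⟨-, rfl⟩, hx⟩ := this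
        simpa using hlet x hx
    exact_mod_cast this
  have hlen : m < p * U.length := by
    by_contra hcon
    push Not at hcon
    have e1 := sum_getD q (wpow U p) (p * U.length) (by rw [length_wpow])
    rw [List.take_of_length_le (by rw [length_wpow]), ws_wpow] at e1
    have e2 := Finset.sum_le_sum_of_subset_of_nonneg
      (f := fun i => ((q : ℝ) - ((wpow U p).getD i 0 : ℕ)))
      (Finset.range_mono hcon) (fun i _ _ => by have := hgetD i; linarith)
    linarith
  have hNpos : 0 < U.length := by
    rcases Nat.eq_zero_or_pos U.length with h | h
    · rw [h] at hlen; omega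
    · exact h
  obtain ⟨j, i, hmi, hi⟩ : ∃ j i, m = j * U.length + i ∧ i < U.length :=
    ⟨m / U.length, m % U.length, (Nat.div_add_mod' _ _).symm, Nat.mod_lt _ hNpos⟩
  have hj : j < p := by
    by_contra hcon
    push Not at hcon
    have := Nat.mul_le_mul_right U.length hcon
    omega
  rw [sum_getD _ _ _ (by rw [length_wpow]; omega), hmi, take_wpow U i hi.le j p hj, ws_append,
    ws_wpow] at hm1
  rw [sum_getD _ _ _ (by rw [length_wpow]; omega), hmi, add_assoc,
    take_wpow U (i + 1) hi j p hj, ws_append, ws_wpow] at hm2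
  have hlo := gU.1 i hi
  have hhi := gU.2 (i + 1)
  have hu : 0 < r ^ (k + 1) := pow_pos hr _
  have hrk : r ^ k = a * r ^ (k + 1) := by rw [pow_succ]; linear_combination (-r^k) * har
  have hletq : ∀ x ∈ U, (x : ℝ) ≤ q := fun x hx => by
    have : (x : ℝ) ≤ 3 := by exact_mod_cast hlet x hx
    linarith
  have n1 : 0 ≤ ws q (U.take i) := ws_nonneg _ _ fun x hx => hletq x (List.mem_of_mem_take hx)
  have n2 : ws q (U.take (i + 1)) ≤ ws q U := by
    have e : ws q U = ws q (U.take (i + 1)) + ws q (U.drop (i + 1)) := by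
      rw [← ws_append, List.take_append_drop]
    have := ws_nonneg q (U.drop (i + 1)) fun x hx => hletq x (List.mem_of_mem_drop hx)
    linarith
  have hlpos : 0 < ws q U := by
    have : (0 : ℝ) < U.length := by exact_mod_cast hNpos
    unfold dl at dU
    by_contra hcon
    push Not at hcon
    nlinarith
  have hfl : ⌊(t : ℝ) / ws q U⌋ = (j : ℤ) := by
    rw [Int.floor_eq_iff, le_div_iff₀ hlpos, div_lt_iff₀ hlpos]
    push_cast
    constructor <;> linarith
  rw [hfl]
  -- t + 1 ≤ S_{m+1}
  have hm3 : (t : ℝ) + 1 ≤ j * ws q U + ws q (U.take (i + 1)) := by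
    have hzz : ∀ X : List ℕ, ∃ y : ℤ, ws q X = y := by
      intro X
      induction X with
      | nil => exact ⟨0, by simp [ws]⟩
      | cons x X ih =>
        obtain ⟨y, hy⟩ := ih
        refine ⟨q - x + y, ?_⟩
        have : ws q (x :: X) = (q - x) + ws q X := by simp [ws]
        rw [this, hy]; push_cast; ring
    obtain ⟨y1, hy1⟩ := hzz U
    obtain ⟨y2, hy2⟩ := hzz (U.take (i + 1))
    rw [hy1, hy2] at hm2 ⊢
    have : t < j * y1 + y2 := by exact_mod_cast hm2
    exact_mod_cast this
  symm
  rw [Int.floor_eq_iff, hmi]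
  unfold dl at dU hlo hhi
  rw [List.length_take, min_eq_left hi.le] at hlo
  rw [List.length_take, min_eq_left hi] at hhi
  rw [hrk] at hlo
  generalize r ^ (k + 1) = u at *
  push_cast at *
  have m1 := mul_le_mul_of_nonneg_right hm1 hB0.le
  have m3 := mul_le_mul_of_nonneg_right hm3 hB0.le
  have hbu : u * (a - b) * B = u * (a * B) - u := by linear_combination (-u) * hbB
  have hu2 : 0 < u * (a * B - 2) := mul_pos hu (by linarith)
  have dj : (j : ℝ) * (ws q U * B) = j * U.length + j * u := by
    linear_combination (j : ℝ) * dU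
  constructor
  · linarith
  · linarith
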